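/- arXiv:1005.5179 — 3 statements merged into one kernel-verified Lean document; each statement's English description precedes it below -/
import Mathlib

section
/- Let O be the ring of integers of an imaginary quadratic field, let k ≥ ℓ ≥ 0 be integers with k + ℓ even, and let R = O[1/k!] be the localization of O inverting k!. Then there exists a PSL₂(O)-equivariant perfect R-bilinear pairing E_{k,ℓ}(R) × E_{k,ℓ}(R) → R, where PSL₂(O) acts trivially on R; that is, a bilinear form ⟨·,·⟩ such that the induced map E_{k,ℓ}(R) → Hom_R(E_{k,ℓ}(R), R) is an isomorphism and ⟨v·g, w·g⟩ = ⟨v,w⟩ for all g ∈ PSL₂(O). -/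
/-!
STATEMENT 0: For `O` the ring of integers of an imaginary quadratic field, `k ≥ ℓ` with
`k + ℓ` even and `R = O[1/k!]`, there is a `PSL₂(O)`-equivariant perfect `R`-bilinear
pairing on `E_{k,ℓ}(R) = E_{k,ℓ}(O) ⊗_O R`.  Since the `PSL₂(O)`-action is induced by the
`SL₂(O)`-action on polynomials (with `−Id` acting trivially as `k+ℓ` is even), equivariance
is expressed by quantifying over matrices `g ∈ SL₂(O)`.
-/

open scoped MatrixGroups TensorProduct

/-- `E k R`: homogeneous polynomials of degree `k` in the two variables `X 0, X 1` over `R`. -/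
abbrev EE (R : Type) [CommRing R] (k : ℕ) : Type :=
  MvPolynomial.homogeneousSubmodule (Fin 2) R k

/-- The right action of a 2×2 matrix `g` on `E k R`:
`(P · g)(X, Y) = P (g₀₀ X + g₀₁ Y, g₁₀ X + g₁₁ Y)`.  (On homogeneous polynomials of degree
`k` the substitution is again homogeneous of degree `k`, so taking the `k`-th homogeneous
component after substituting is the genuine action.) -/
noncomputable def polyAct (R : Type) [CommRing R] (k : ℕ) (g : Matrix (Fin 2) (Fin 2) R) :
    EE R k →ₗ[R] EE R k :=
  LinearMap.codRestrict (MvPolynomial.homogeneousSubmodule (Fin 2) R k)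
    ((MvPolynomial.homogeneousComponent k) ∘ₗ
      (MvPolynomial.aeval (R := R) (S₁ := MvPolynomial (Fin 2) R)
        (fun i : Fin 2 => MvPolynomial.C (g i 0) * MvPolynomial.X 0
          + MvPolynomial.C (g i 1) * MvPolynomial.X 1)).toLinearMap ∘ₗ
      (MvPolynomial.homogeneousSubmodule (Fin 2) R k).subtype)
    (fun _ => (MvPolynomial.mem_homogeneousSubmodule _ _).2
      (MvPolynomial.homogeneousComponent_isHomogeneous _ _))

/-- `E_{k,ℓ}(O) = E_k(O) ⊗_O E_ℓ(O)` (second factor to be twisted by conjugation). -/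
abbrev EKL (O : Type) [CommRing O] (k l : ℕ) : Type := EE O k ⊗[O] EE O l

/-- The right action of `g` on `E_{k,ℓ}(O)`: `g` on the first factor and the entrywise
conjugate `σ(g)` on the second factor. -/
noncomputable def EklAct (O : Type) [CommRing O] (k l : ℕ) (σ : O ≃+* O)
    (g : Matrix (Fin 2) (Fin 2) O) : EKL O k l →ₗ[O] EKL O k l :=
  TensorProduct.map (polyAct O k g) (polyAct O l (g.map σ))

open MvPolynomial in
/-- The constant coefficient derivation attached to the linear form `a X + b Y`. -/
noncomputable def dl {R : Type} [CommRing R] (a b : R) : Module.End R (MvPolynomial (Fin 2) R) :=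
  a • (pderiv (R := R) (1 : Fin 2)).toLinearMap - b • (pderiv (R := R) (0 : Fin 2)).toLinearMap

/-- The substitution attached to a matrix. -/
noncomputable def gsub {R : Type} [CommRing R] (g : Matrix (Fin 2) (Fin 2) R) :
    MvPolynomial (Fin 2) R →ₐ[R] MvPolynomial (Fin 2) R :=
  MvPolynomial.aeval (R := R) (S₁ := MvPolynomial (Fin 2) R)
        (fun i : Fin 2 => MvPolynomial.C (g i 0) * MvPolynomial.X 0
          + MvPolynomial.C (g i 1) * MvPolynomial.X 1)

section
open MvPolynomial

variable {R : Type} [CommRing R]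

theorem dl_apply (a b : R) (p : MvPolynomial (Fin 2) R) :
    dl a b p = C a * pderiv 1 p - C b * pderiv 0 p := by
  simp [dl, MvPolynomial.smul_eq_C_mul]

theorem dl_mul (a b : R) (p q : MvPolynomial (Fin 2) R) :
    dl a b (p * q) = dl a b p * q + p * dl a b q := by
  simp only [dl_apply, Derivation.leibniz, smul_eq_mul]
  ring

theorem dl_lin (a b : R) : dl a b = a • dl 1 0 + b • dl 0 1 := by
  ext1 p
  simp [dl, sub_eq_add_neg]

theorem dl_gsub (g : Matrix (Fin 2) (Fin 2) R) (hg : g.det = 1) (a b : R)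
    (q : MvPolynomial (Fin 2) R) :
    dl (a * g 0 0 + b * g 1 0) (a * g 0 1 + b * g 1 1) (gsub g q) = gsub g (dl a b q) := by
  rw [Matrix.det_fin_two] at hg
  induction q using MvPolynomial.induction_on with
  | C c => simp [dl_apply, gsub]
  | add p q hp hq => simp only [map_add, hp, hq]
  | mul_X p i hp =>
    rw [map_mul, dl_mul, hp, dl_mul, map_add, map_mul, map_mul]
    congr 2
    have h1 : (C (g 0 0) * C (g 1 1) - C (g 0 1) * C (g 1 0) : MvPolynomial (Fin 2) R) = 1 := by
      rw [← C_mul, ← C_mul, ← C_sub, hg, C_1]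
    fin_cases i
    · simp [dl_apply, gsub, pderiv_X, Pi.single_apply]
      linear_combination (-C b) * h1
    · simp [dl_apply, gsub, pderiv_X, Pi.single_apply]
      linear_combination (C a) * h1

theorem constantCoeff_gsub (g : Matrix (Fin 2) (Fin 2) R) (q : MvPolynomial (Fin 2) R) :
    constantCoeff (gsub g q) = constantCoeff q := by
  induction q using MvPolynomial.induction_on with
  | C c => simp [gsub]
  | add p q hp hq => simp only [map_add, hp, hq]
  | mul_X p i hp => simp [gsub]

variable (R) in
/-- The differential operator attached to a polynomial. -/
noncomputable def TT : MvPolynomial (Fin 2) R →ₗ[R] Module.End R (MvPolynomial (Fin 2) R) :=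
  (basisMonomials (Fin 2) R).constr R (fun m => (dl 1 0) ^ (m 0) * (dl 0 1) ^ (m 1))

theorem TT_monomial (m : Fin 2 →₀ ℕ) :
    TT R (monomial m 1) = (dl 1 0) ^ (m 0) * (dl 0 1) ^ (m 1) := by
  have := (basisMonomials (Fin 2) R).constr_basis R
    (fun m => (dl (R := R) 1 0) ^ (m 0) * (dl 0 1) ^ (m 1)) m
  simpa [TT] using this

theorem dl_comm : Commute (dl (1 : R) 0) (dl 0 1) := by
  unfold Commute SemiconjBy
  refine LinearMap.ext fun p => ?_
  induction p using MvPolynomial.induction_on' with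
  | monomial m a =>
    simp [dl_apply, pderiv_monomial, mul_right_comm, tsub_right_comm]
  | add p q hp hq => simp only [map_add, hp, hq]

theorem TT_X0 (p : MvPolynomial (Fin 2) R) : TT R (X 0 * p) = dl 1 0 * TT R p := by
  suffices h : TT R ∘ₗ LinearMap.mulLeft R (X 0) = LinearMap.mulLeft R (dl 1 0) ∘ₗ TT R from
    LinearMap.congr_fun h p
  refine (basisMonomials (Fin 2) R).ext fun m => ?_
  have : (X 0 * monomial m 1 : MvPolynomial (Fin 2) R) = monomial (Finsupp.single 0 1 + m) 1 := by
    rw [X, monomial_mul, one_mul]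
  simp only [coe_basisMonomials, LinearMap.comp_apply, LinearMap.mulLeft_apply, this, TT_monomial]
  simp [pow_add, mul_assoc]

theorem TT_X1 (p : MvPolynomial (Fin 2) R) : TT R (X 1 * p) = dl 0 1 * TT R p := by
  suffices h : TT R ∘ₗ LinearMap.mulLeft R (X 1) = LinearMap.mulLeft R (dl 0 1) ∘ₗ TT R from
    LinearMap.congr_fun h p
  refine (basisMonomials (Fin 2) R).ext fun m => ?_
  have : (X 1 * monomial m 1 : MvPolynomial (Fin 2) R) = monomial (Finsupp.single 1 1 + m) 1 := by
    rw [X, monomial_mul, one_mul]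
  simp only [coe_basisMonomials, LinearMap.comp_apply, LinearMap.mulLeft_apply, this, TT_monomial]
  simp only [Finsupp.add_apply, pow_add, Finsupp.single_eq_same, pow_one]
  rw [← mul_assoc (dl 0 1) (dl 1 0 ^ m 0), ← (dl_comm.pow_left (m 0)).eq]
  simp [mul_assoc]

theorem TT_lin (a b : R) (p : MvPolynomial (Fin 2) R) :
    TT R ((C a * X 0 + C b * X 1) * p) = dl a b * TT R p := by
  rw [add_mul, mul_assoc, mul_assoc, ← smul_eq_C_mul, ← smul_eq_C_mul, map_add, map_smul,
    map_smul, TT_X0, TT_X1, dl_lin a b, add_mul, smul_mul_assoc, smul_mul_assoc]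

theorem TT_gsub (g : Matrix (Fin 2) (Fin 2) R) (hg : g.det = 1) (p q : MvPolynomial (Fin 2) R) :
    TT R (gsub g p) (gsub g q) = gsub g (TT R p q) := by
  induction p using MvPolynomial.induction_on generalizing q with
  | C c =>
    have h : TT R (C c) = c • 1 := by
      have := TT_monomial (R := R) 0
      rw [show (C c : MvPolynomial (Fin 2) R) = c • monomial 0 1 by
          rw [smul_monomial, smul_eq_mul, mul_one, C_apply],
        map_smul, this]
      simp
    simp [gsub] at h ⊢
    simp [h]
  | add p p' hp hq => simp only [map_add, hp, hq, LinearMap.add_apply]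
  | mul_X p i hp =>
    have key : gsub g (X i) = C (g i 0) * X 0 + C (g i 1) * X 1 := by simp [gsub]
    rw [mul_comm, map_mul, key, TT_lin, Module.End.mul_apply, hp]
    fin_cases i
    · simpa [TT_X0] using dl_gsub g hg 1 0 (TT R p q)
    · simpa [TT_X1] using dl_gsub g hg 0 1 (TT R p q)

variable (R) in
/-- The pairing on degree `k` forms. -/
noncomputable def Bk (k : ℕ) : LinearMap.BilinForm R (EE R k) :=
  ((TT R).compr₂ (lcoeff R 0)).compl₁₂ (homogeneousSubmodule (Fin 2) R k).subtype
    (homogeneousSubmodule (Fin 2) R k).subtype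

theorem Bk_apply (k : ℕ) (p q : EE R k) :
    Bk R k p q = constantCoeff (TT R (p : MvPolynomial (Fin 2) R) q) := rfl

theorem polyAct_coe (k : ℕ) (g : Matrix (Fin 2) (Fin 2) R) (p : EE R k) :
    (polyAct R k g p : MvPolynomial (Fin 2) R) = gsub g p := by
  have h : (gsub g (p : MvPolynomial (Fin 2) R)).IsHomogeneous (1 * k) :=
    IsHomogeneous.aeval ((mem_homogeneousSubmodule _ _).1 p.2) _ (fun i =>
      ((isHomogeneous_C_mul_X _ _).add (isHomogeneous_C_mul_X _ _)))
  rw [one_mul] at h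
  change homogeneousComponent k (gsub g (p : MvPolynomial (Fin 2) R)) = _
  rw [homogeneousComponent_of_mem ((mem_homogeneousSubmodule _ _).2 h), if_pos rfl]

theorem Bk_inv (k : ℕ) (g : Matrix (Fin 2) (Fin 2) R) (hg : g.det = 1) (p q : EE R k) :
    Bk R k (polyAct R k g p) (polyAct R k g q) = Bk R k p q := by
  rw [Bk_apply, polyAct_coe, polyAct_coe, TT_gsub g hg, constantCoeff_gsub, Bk_apply]

/-- exponent `(i, k - i)`. -/
noncomputable def expo (k : ℕ) (i : Fin (k + 1)) : Fin 2 →₀ ℕ :=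
  Finsupp.single 0 (i : ℕ) + Finsupp.single 1 (k - i)

theorem expo_zero (k : ℕ) (i : Fin (k + 1)) : expo k i 0 = i := by simp [expo]
theorem expo_one (k : ℕ) (i : Fin (k + 1)) : expo k i 1 = k - i := by simp [expo]

theorem expo_degree (k : ℕ) (i : Fin (k + 1)) : (expo k i).degree = k := by
  have := i.2
  rw [Finsupp.degree_eq_sum, Fin.sum_univ_two, expo_zero, expo_one]
  omega

theorem expo_inj (k : ℕ) : Function.Injective (expo k) := fun i j h => by
  have := DFunLike.congr_fun h 0
  rw [expo_zero, expo_zero] at this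
  exact Fin.ext this

variable (R) in
/-- The monomial family. -/
noncomputable def mon (k : ℕ) (i : Fin (k + 1)) : EE R k :=
  ⟨monomial (expo k i) 1, (mem_homogeneousSubmodule _ _).2
    (isHomogeneous_monomial _ (expo_degree k i))⟩

theorem mon_li (k : ℕ) : LinearIndependent R (mon R k) := by
  have h := (basisMonomials (Fin 2) R).linearIndependent.comp _ (expo_inj k)
  refine LinearIndependent.of_comp (homogeneousSubmodule (Fin 2) R k).subtype ?_
  convert h using 1
  ext1 i
  simp [mon]

theorem mon_span (k : ℕ) : ⊤ ≤ Submodule.span R (Set.range (mon R k)) := by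
  rintro ⟨p, hp⟩ -
  have hmap : p ∈ (Submodule.span R (Set.range (mon R k))).map
      (homogeneousSubmodule (Fin 2) R k).subtype := by
    rw [as_sum p]
    refine Submodule.sum_mem _ fun m hm => ?_
    have hd : m.degree = k := by
      by_contra hne
      exact (mem_support_iff.1 hm) (IsHomogeneous.coeff_eq_zero
        ((mem_homogeneousSubmodule _ _).1 hp) hne)
    have hd' : m 0 + m 1 = k := by
      rw [← hd, Finsupp.degree_eq_sum, Fin.sum_univ_two]
    have he : expo k ⟨m 0, by omega⟩ = m := by
      ext j
      fin_cases j
      · exact expo_zero _ _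
      · refine (expo_one _ _).trans ?_
        simp only
        change k - m 0 = m 1
        omega
    refine ⟨coeff m p • mon R k ⟨m 0, by omega⟩,
      Submodule.smul_mem _ _ (Submodule.subset_span ⟨_, rfl⟩), ?_⟩
    simp [mon, he, smul_monomial]
  obtain ⟨q, hq, hqp⟩ := hmap
  have : q = ⟨p, hp⟩ := Subtype.ext hqp
  exact this ▸ hq

variable (R) in
/-- The monomial basis. -/
noncomputable def monB (k : ℕ) : Module.Basis (Fin (k + 1)) R (EE R k) :=
  Module.Basis.mk (mon_li k) (mon_span k)

theorem dl10_pow (n : ℕ) (m : Fin 2 →₀ ℕ) (c : R) :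
    (dl (1 : R) 0 ^ n) (monomial m c) =
      monomial (m - Finsupp.single 1 n) (c * ((m 1).descFactorial n : R)) := by
  induction n with
  | zero => simp
  | succ n ih =>
    rw [pow_succ', Module.End.mul_apply, ih, dl_apply, pderiv_monomial, C_1, C_0, one_mul, zero_mul,
      sub_zero, tsub_tsub, ← Finsupp.single_add, Nat.descFactorial_succ]
    congr 1
    simp
    ring

theorem dl01_pow (n : ℕ) (m : Fin 2 →₀ ℕ) (c : R) :
    (dl (0 : R) 1 ^ n) (monomial m c) =
      monomial (m - Finsupp.single 0 n) ((-1) ^ n * c * ((m 0).descFactorial n : R)) := by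
  induction n with
  | zero => simp
  | succ n ih =>
    rw [pow_succ', Module.End.mul_apply, ih, dl_apply, C_1, C_0, zero_mul,
      zero_sub, one_mul, pderiv_monomial, tsub_tsub, ← Finsupp.single_add, Nat.descFactorial_succ, ← map_neg]
    congr 1
    simp [pow_succ]
    ring

theorem Bk_mon (k : ℕ) (i j : Fin (k + 1)) :
    Bk R k (monB R k i) (monB R k j) =
      if j = Fin.rev i then (-1) ^ (k - i : ℕ) * (((k - i : ℕ).factorial * (i : ℕ).factorial : ℕ) : R)
        else 0 := by
  have hi := i.2
  have hj := j.2
  rw [monB, Module.Basis.mk_apply, Module.Basis.mk_apply, Bk_apply]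
  simp only [mon]
  rw [TT_monomial, Module.End.mul_apply, dl01_pow, dl10_pow, constantCoeff_monomial]
  simp only [Finsupp.tsub_apply, expo_zero, expo_one, Finsupp.single_apply]
  by_cases h4 : j = Fin.rev i
  · have h3 : expo k j - Finsupp.single 0 (k - (i : ℕ)) - Finsupp.single 1 (i : ℕ) = 0 := by
      subst h4
      ext t
      fin_cases t
      · simp [expo, Fin.val_rev]
      · simp [expo, Fin.val_rev]
        omega
    rw [if_pos h4, if_pos h3]
    subst h4
    simp [Fin.val_rev, Nat.descFactorial_self, show k - (k - (i : ℕ)) = i by omega, mul_assoc]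
  · rw [if_neg h4]
    have : (j : ℕ) ≠ k - i := fun h => h4 (Fin.ext (by rw [Fin.val_rev]; omega))
    rcases lt_or_gt_of_ne this with h | h
    · simp [Nat.descFactorial_eq_zero_iff_lt.2 h]
    · have : k - (j : ℕ) < i := by omega
      simp [Nat.descFactorial_eq_zero_iff_lt.2 this]

end

theorem bij_of_gram {R M ι : Type*} [CommRing R] [AddCommGroup M] [Module R M] [Finite ι]
    (b : Module.Basis ι R M) (B : M →ₗ[R] M →ₗ[R] R) (τ : Equiv.Perm ι) (u : ι → R)
    (hu : ∀ i, IsUnit (u i)) (h1 : ∀ i, B (b i) (b (τ i)) = u i)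
    (h0 : ∀ i j, j ≠ τ i → B (b i) (b j) = 0) : Function.Bijective B := by
  classical
  let b' := (b.dualBasis.reindex τ.symm).unitsSMul (fun i => (hu i).unit)
  have : B = (b.equiv b' (Equiv.refl ι)).toLinearMap := by
    refine b.ext fun i => b.ext fun j => ?_
    by_cases hj : j = τ i
    · subst hj
      simp [b', Module.Basis.unitsSMul_apply, h1, Units.smul_def]
    · simp [b', Module.Basis.unitsSMul_apply, h0 i j hj, Units.smul_def, Module.Basis.dualBasis_apply_self,
        Finsupp.single_apply, hj]
  rw [this]
  exact (b.equiv b' (Equiv.refl ι)).bijective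

theorem unit_aux {O A : Type*} [CommRing O] [CommRing A] [Algebra O A] (k n i : ℕ)
    (hk : IsUnit (algebraMap O A (k.factorial : O))) (hn : n ≤ k) (hi : i ≤ n) :
    IsUnit (algebraMap O A ((-1) ^ (n - i) * (((n - i).factorial * i.factorial : ℕ) : O))) := by
  have hd : (n - i).factorial * i.factorial ∣ k.factorial := by
    refine dvd_trans ?_ (Nat.factorial_dvd_factorial hn)
    rw [mul_comm]
    exact Nat.factorial_mul_factorial_dvd_factorial hi
  rw [map_mul]
  refine IsUnit.mul ?_ (isUnit_of_dvd_unit ?_ hk)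
  · rw [map_pow, map_neg, map_one]
    exact (isUnit_one.neg).pow _
  · exact map_dvd _ (by exact_mod_cast Nat.cast_dvd_cast hd)

theorem main_aux (O A : Type) [CommRing O] [CommRing A] [Algebra O A] (σ : O ≃+* O) (k l : ℕ)
    (hkl : l ≤ k) (hk : IsUnit (algebraMap O A (k.factorial : O))) :
    ∃ B : (A ⊗[O] EKL O k l) →ₗ[A] (A ⊗[O] EKL O k l) →ₗ[A] A,
      Function.Bijective B ∧
      ∀ (g : SL(2, O)) (v w),
        B (LinearMap.baseChange _ (EklAct _ k l σ g) v)
          (LinearMap.baseChange _ (EklAct _ k l σ g) w) = B v w := by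
  let B0 : LinearMap.BilinForm O (EKL O k l) := LinearMap.BilinForm.tmul (Bk O k) (Bk O l)
  have hB0 : ∀ p q p' q', B0 (p ⊗ₜ q) (p' ⊗ₜ q') = Bk O l q q' * Bk O k p p' :=
    fun p q p' q' => rfl
  refine ⟨LinearMap.BilinForm.baseChange A B0, ?_, ?_⟩
  · let c : ∀ n : ℕ, Fin (n + 1) → O := fun n i =>
      (-1) ^ (n - i : ℕ) * (((n - i : ℕ).factorial * (i : ℕ).factorial : ℕ) : O)
    refine bij_of_gram (((monB O k).tensorProduct (monB O l)).baseChange A) _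
      (Equiv.prodCongr Fin.revPerm Fin.revPerm)
      (fun x => algebraMap O A (c l x.2) * algebraMap O A (c k x.1)) ?_ ?_ ?_
    · rintro ⟨i, j⟩
      exact (unit_aux k l j hk hkl (by omega)).mul (unit_aux k k i hk le_rfl (by omega))
    · rintro ⟨i, j⟩
      simp only [Module.Basis.baseChange_apply, Module.Basis.tensorProduct_apply,
        LinearMap.BilinForm.baseChange_tmul, Equiv.prodCongr_apply, Prod.map, Fin.revPerm_apply,
        hB0, Bk_mon, if_true, c, Algebra.smul_def, map_mul, mul_one]
    · rintro ⟨i, j⟩ ⟨i', j'⟩ hne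
      simp only [Module.Basis.baseChange_apply, Module.Basis.tensorProduct_apply,
        LinearMap.BilinForm.baseChange_tmul, hB0, Bk_mon]
      by_cases h : i' = Fin.rev i
      · have : j' ≠ Fin.rev j := fun h' => hne (by simp [h, h'])
        simp [this]
      · simp [h]
  · intro g v w
    have hg : (g : Matrix (Fin 2) (Fin 2) O).det = 1 := g.2
    have hg' : ((g : Matrix (Fin 2) (Fin 2) O).map σ).det = 1 := by
      have := RingHom.map_det (σ : O →+* O) (g : Matrix (Fin 2) (Fin 2) O)
      rw [hg, map_one] at this
      exact this.symm
    have h0 : ∀ v w, B0 (EklAct O k l σ g v) (EklAct O k l σ g w) = B0 v w := by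
      intro v w
      induction v using TensorProduct.induction_on with
      | zero => simp
      | add x y hx hy => simp only [map_add, LinearMap.add_apply, hx, hy]
      | tmul p q =>
        induction w using TensorProduct.induction_on with
        | zero => simp
        | add x y hx hy => simp only [map_add, hx, hy]
        | tmul p' q' =>
          rw [EklAct, TensorProduct.map_tmul, TensorProduct.map_tmul, hB0, hB0, Bk_inv _ _ hg,
            Bk_inv _ _ hg']
    induction v using TensorProduct.induction_on with
    | zero => simp
    | add x y hx hy => simp only [map_add, LinearMap.add_apply, hx, hy]
    | tmul a p =>
      induction w using TensorProduct.induction_on with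
      | zero => simp
      | add x y hx hy => simp only [map_add, hx, hy]
      | tmul a' p' =>
        rw [LinearMap.baseChange_tmul, LinearMap.baseChange_tmul,
          LinearMap.BilinForm.baseChange_tmul, LinearMap.BilinForm.baseChange_tmul, h0]

theorem perfect_pairing_on_Ekl
    (K : Type) [Field K] [NumberField K]
    (hquad : Module.finrank ℚ K = 2) (himag : IsEmpty (K →+* ℝ))
    (σ : NumberField.RingOfIntegers K ≃+* NumberField.RingOfIntegers K)
    (hσ : σ ≠ RingEquiv.refl _)
    (k l : ℕ) (hkl : l ≤ k) (heven : Even (k + l)) :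
    ∃ B : (Localization.Away ((k.factorial : NumberField.RingOfIntegers K))
            ⊗[NumberField.RingOfIntegers K] EKL (NumberField.RingOfIntegers K) k l) →ₗ[Localization.Away ((k.factorial : NumberField.RingOfIntegers K))]
          (Localization.Away ((k.factorial : NumberField.RingOfIntegers K))
            ⊗[NumberField.RingOfIntegers K] EKL (NumberField.RingOfIntegers K) k l) →ₗ[Localization.Away ((k.factorial : NumberField.RingOfIntegers K))]
          Localization.Away ((k.factorial : NumberField.RingOfIntegers K)),
      Function.Bijective B ∧
      ∀ (g : SL(2, NumberField.RingOfIntegers K)) (v w),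
        B (LinearMap.baseChange _ (EklAct _ k l σ g) v)
          (LinearMap.baseChange _ (EklAct _ k l σ g) w) = B v w := by
  exact main_aux _ _ σ k l hkl (IsLocalization.Away.algebraMap_isUnit _)
end

section
/- Let K be an imaginary quadratic field of class number one with ring of integers O, and let p ⊂ O be a prime ideal of residue degree one. Let Γ₀(p) be the subgroup of PSL₂(O) consisting of images of matrices (a b; c d) ∈ SL₂(O) with c ∈ p. Then the action of Γ₀(p) on the projective line P¹(K) has exactly two orbits, represented by the points [1:0] (the cusp ∞) and [0:1] (the cusp 0). -/
theorem exists_coprime_rep (R K : Type) [CommRing R] [IsDomain R] [IsPrincipalIdealRing R]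
    [Field K] [Algebra R K] [IsFractionRing R K] (v : Fin 2 → K) (hv : v ≠ 0) :
    ∃ (l : K) (a b u w : R), l ≠ 0 ∧ v 0 = l * algebraMap R K a ∧ v 1 = l * algebraMap R K b ∧
      u * a + w * b = 1 := by
  obtain ⟨x, s, hs, hx⟩ := IsFractionRing.div_surjective (A := R) (v 0)
  obtain ⟨y, t, ht, hy⟩ := IsFractionRing.div_surjective (A := R) (v 1)
  have hs0 : s ≠ 0 := nonZeroDivisors.ne_zero hs
  have ht0 : t ≠ 0 := nonZeroDivisors.ne_zero ht
  have hinj := IsFractionRing.injective R K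
  have hs' : algebraMap R K s ≠ 0 := by simpa using hs0
  have ht' : algebraMap R K t ≠ 0 := by simpa using ht0
  obtain ⟨d, hd⟩ := (IsPrincipalIdealRing.principal (Ideal.span {x * t, y * s})).principal
  have hd : Ideal.span {x * t, y * s} = Ideal.span {d} := hd
  have h1 : x * t ∈ Ideal.span {d} := hd ▸ Ideal.subset_span (by simp)
  have h2 : y * s ∈ Ideal.span {d} := hd ▸ Ideal.subset_span (by simp)
  have h3 : d ∈ Ideal.span {x * t, y * s} := hd ▸ Ideal.mem_span_singleton_self d
  obtain ⟨a, ha⟩ := Ideal.mem_span_singleton.1 h1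
  obtain ⟨b, hb⟩ := Ideal.mem_span_singleton.1 h2
  obtain ⟨u, w, huw⟩ := Ideal.mem_span_pair.1 h3
  have ha' := congrArg (algebraMap R K) ha
  have hb' := congrArg (algebraMap R K) hb
  simp only [map_mul] at ha' hb'
  have e0 : v 0 = (algebraMap R K d / (algebraMap R K s * algebraMap R K t)) *
      algebraMap R K a := by
    rw [← hx]; field_simp; linear_combination ha'
  have e1 : v 1 = (algebraMap R K d / (algebraMap R K s * algebraMap R K t)) *
      algebraMap R K b := by
    rw [← hy]; field_simp; linear_combination hb'
  have hd0 : d ≠ 0 := by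
    rintro rfl
    apply hv
    ext i
    fin_cases i
    · simpa using e0
    · simpa using e1
  refine ⟨_, a, b, u, w, ?_, e0, e1, ?_⟩
  · have : algebraMap R K d ≠ 0 := by simpa using hd0
    positivity
  · apply mul_left_cancel₀ hd0
    linear_combination huw - u * ha - w * hb

theorem Gamma0_has_two_cusps
    (K : Type) [Field K] [NumberField K]
    (hquad : Module.finrank ℚ K = 2) (himag : IsEmpty (K →+* ℝ))
    (hclass : NumberField.classNumber K = 1)
    (P : Ideal (NumberField.RingOfIntegers K)) (hP : P.IsPrime) (hPbot : P ≠ ⊥)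
    (hdeg1 : (Ideal.absNorm P).Prime) :
    -- every point of `P¹(K)` is in the `Γ₀(p)`-orbit of `[1:0]` or of `[0:1]` ...
    (∀ v : Fin 2 → K, v ≠ 0 →
      (∃ g : Matrix.SpecialLinearGroup (Fin 2) (NumberField.RingOfIntegers K),
        (g : Matrix (Fin 2) (Fin 2) (NumberField.RingOfIntegers K)) 1 0 ∈ P ∧
        ∃ c : K, c ≠ 0 ∧
          ((g : Matrix (Fin 2) (Fin 2) (NumberField.RingOfIntegers K)).map
            (algebraMap (NumberField.RingOfIntegers K) K)).mulVec v = c • ![1, 0]) ∨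
      (∃ g : Matrix.SpecialLinearGroup (Fin 2) (NumberField.RingOfIntegers K),
        (g : Matrix (Fin 2) (Fin 2) (NumberField.RingOfIntegers K)) 1 0 ∈ P ∧
        ∃ c : K, c ≠ 0 ∧
          ((g : Matrix (Fin 2) (Fin 2) (NumberField.RingOfIntegers K)).map
            (algebraMap (NumberField.RingOfIntegers K) K)).mulVec v = c • ![0, 1])) ∧
    -- ... and these two orbits are distinct:
    ¬ (∃ g : Matrix.SpecialLinearGroup (Fin 2) (NumberField.RingOfIntegers K),
        (g : Matrix (Fin 2) (Fin 2) (NumberField.RingOfIntegers K)) 1 0 ∈ P ∧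
        ∃ c : K, c ≠ 0 ∧
          ((g : Matrix (Fin 2) (Fin 2) (NumberField.RingOfIntegers K)).map
            (algebraMap (NumberField.RingOfIntegers K) K)).mulVec ![1, 0] = c • ![0, 1]) := by
  classical
  have : IsPrincipalIdealRing (NumberField.RingOfIntegers K) :=
    NumberField.classNumber_eq_one_iff.1 hclass
  have hmax : P.IsMaximal := hP.isMaximal hPbot
  refine ⟨fun v hv => ?_, ?_⟩
  · obtain ⟨l, a, b, u, w, hl, h0, h1, huw⟩ :=
      exists_coprime_rep (NumberField.RingOfIntegers K) K v hv
    have huw' := congrArg (algebraMap (NumberField.RingOfIntegers K) K) huw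
    simp only [map_mul, map_add, map_one] at huw'
    by_cases hb : b ∈ P
    · left
      refine ⟨⟨!![u, w; -b, a], ?_⟩, ?_, l, hl, ?_⟩
      · rw [Matrix.det_fin_two_of]; linear_combination huw
      · simpa using hb
      · ext i
        fin_cases i
        · simp [Matrix.mulVec, dotProduct, Fin.sum_univ_two, h0, h1]
          linear_combination l * huw'
        · simp [Matrix.mulVec, dotProduct, Fin.sum_univ_two, h0, h1]
          ring
    · right
      obtain ⟨y, i, hi, hy⟩ := hmax.exists_inv hb
      refine ⟨⟨!![b, -a; u - u * y * b, w + u * y * a], ?_⟩, ?_, l, hl, ?_⟩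
      · rw [Matrix.det_fin_two_of]; linear_combination huw
      · have : u - u * y * b = u * i := by linear_combination -u * hy
        simpa [this] using P.mul_mem_left u hi
      · ext i
        fin_cases i
        · simp [Matrix.mulVec, dotProduct, Fin.sum_univ_two, h0, h1]
          ring
        · simp [Matrix.mulVec, dotProduct, Fin.sum_univ_two, h0, h1]
          linear_combination l * huw'
  · rintro ⟨g, hg, c, hc, h⟩
    have h00 := congrFun h 0
    simp [Matrix.mulVec, dotProduct, Fin.sum_univ_two] at h00
    have hdet := g.det_coe
    rw [Matrix.det_fin_two, h00] at hdet
    apply hP.ne_top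
    rw [Ideal.eq_top_iff_one, ← hdet]
    simpa using P.mul_mem_left _ hg
end

section
/- Let G be a group, N a normal abelian subgroup of finite index n in G, and suppose there exists τ ∈ G such that τxτ⁻¹ = x⁻¹ for all x ∈ N. Let R be a commutative ring in which 2 and n are invertible, regarded as a G-module with trivial action. Then H^1(G, R) = 0. -/
/-!
STATEMENT 14: Let `G` be a group, `N` a normal abelian subgroup of finite index `n`, and
`τ ∈ G` with `τxτ⁻¹ = x⁻¹` for all `x ∈ N`.  If `R` is a commutative ring in which `2` and
`n` are invertible (with trivial `G`-action), then `H¹(G, R) = 0`.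
-/

theorem H1_trivial_coeffs_vanishes
    (G : Type) [Group G] (N : Subgroup G) [N.Normal]
    (hab : ∀ x y : N, x * y = y * x)
    [N.FiniteIndex]
    (τ : G) (hτ : ∀ x ∈ N, τ * x * τ⁻¹ = x⁻¹)
    (R : Type) [CommRing R] (h2 : IsUnit (2 : R)) (hn : IsUnit ((N.index : R))) :
    Subsingleton (groupCohomology (Rep.trivial R G R) 1) := by
  have key : ∀ f : Additive G →+ R, f = 0 := by
    intro f
    have hN : ∀ x ∈ N, f (Additive.ofMul x) = 0 := by
      intro x hx
      have h := congrArg (fun g => f (Additive.ofMul g)) (hτ x hx)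
      simp only [ofMul_mul, ofMul_inv, map_add, map_neg] at h
      have h' : (2 : R) * f (Additive.ofMul x) = 0 := by linear_combination h
      exact (h2.mul_right_eq_zero).1 h'
    refine AddMonoidHom.ext fun g => ?_
    have h := hN _ (N.pow_index_mem g.toMul)
    rw [ofMul_pow, map_nsmul, nsmul_eq_mul] at h
    exact (hn.mul_right_eq_zero).1 h
  have e := (groupCohomology.H1IsoOfIsTrivial (Rep.trivial R G R)).toLinearEquiv
  have : Subsingleton (Additive G →+ R) := ⟨fun a b => (key a).trans (key b).symm⟩
  have : Subsingleton (ModuleCat.of R (Additive G →+ (Rep.trivial R G R))) := this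
  exact e.toEquiv.subsingleton
end
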